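/- Let p be an odd prime, α, β : ℕ, 𝒞 an additive subgroup of (Fin α → ZMod p) × (Fin β → ZMod (p²)), and C = Φ '' 𝒞. Then the kernel of C equals the Gray image of the set of codewords whose carry corrections all lie in 𝒞: K(C) = Φ '' {u ∈ 𝒞 : ∀ v ∈ 𝒞, pP(u,v) ∈ 𝒞}. -/

import Mathlib

/-- The Gray map `φ : ZMod (p²) → (Fin p → ZMod p)`. -/
def gray (p : ℕ) (θ : ZMod (p ^ 2)) : Fin p → ZMod p :=
  fun i => ((θ.val / p : ℕ) : ZMod p) + ((θ.val % p : ℕ) : ZMod p) * ((i : ℕ) : ZMod p)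

/-- The extended Gray map `Φ`. -/
def Gray (p α β : ℕ) (u : (Fin α → ZMod p) × (Fin β → ZMod (p ^ 2))) :
    (Fin α → ZMod p) × (Fin β → Fin p → ZMod p) :=
  (u.1, fun j => gray p (u.2 j))

/-- The carry `c(u,v)`. -/
def carry (p : ℕ) (u v : ZMod (p ^ 2)) : ℕ :=
  if p ≤ u.val % p + v.val % p then 1 else 0

/-- `pP(u,v)`. -/
def pP (p α β : ℕ) (u v : (Fin α → ZMod p) × (Fin β → ZMod (p ^ 2))) :
    (Fin α → ZMod p) × (Fin β → ZMod (p ^ 2)) :=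
  (0, fun j => (p : ZMod (p ^ 2)) * ((carry p (u.2 j) (v.2 j) : ℕ) : ZMod (p ^ 2)))

/-- The kernel `K(C) = {x : x + C = C}` of a subset `C`. -/
def kernelSet {V : Type*} [AddCommGroup V] (C : Set V) : Set V :=
  {x | (fun c => x + c) '' C = C}

theorem gray_mk (p : ℕ) (hp : p.Prime) (a b : ℕ) (i : Fin p) :
    gray p ((a + p * b : ℕ) : ZMod (p ^ 2)) i =
      ((a / p + b : ℕ) : ZMod p) + (a : ZMod p) * ((i : ℕ) : ZMod p) := by
  have hpp := hp.pos
  unfold gray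
  rw [ZMod.val_natCast, pow_two, Nat.mod_mul_right_div_self, Nat.mod_mul_right_mod,
    ZMod.natCast_mod, ZMod.natCast_mod, Nat.add_mul_div_left _ _ hpp]
  simp

theorem gray_add (p : ℕ) (hp : p.Prime) (u v : ZMod (p ^ 2)) :
    gray p u + gray p v = gray p (u + v - (p : ZMod (p ^ 2)) * ((carry p u v : ℕ) : ZMod (p ^ 2))) := by
  have hpp := hp.pos
  have : NeZero p := ⟨hp.ne_zero⟩
  have hu := Nat.mod_add_div u.val p
  have hv := Nat.mod_add_div v.val p
  have ha := Nat.mod_lt u.val hpp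
  have hc := Nat.mod_lt v.val hpp
  have hk : p * carry p u v ≤ u.val % p + v.val % p := by
    unfold carry; split_ifs <;> simp; omega
  have hlt : u.val % p + v.val % p - p * carry p u v < p := by
    unfold carry; split_ifs <;> simp <;> omega
  obtain ⟨e, he⟩ := Nat.exists_eq_add_of_le hk
  have he' : e < p := by omega
  have hw : u + v - (p : ZMod (p ^ 2)) * ((carry p u v : ℕ) : ZMod (p ^ 2)) =
      ((e + p * (u.val / p + v.val / p) : ℕ) : ZMod (p ^ 2)) := by
    rw [sub_eq_iff_eq_add]
    have : u + v = ((u.val + v.val : ℕ) : ZMod (p ^ 2)) := by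
      push_cast
      rw [ZMod.natCast_zmod_val, ZMod.natCast_zmod_val]
    rw [this, ← Nat.cast_mul, ← Nat.cast_add]
    congr 1
    rw [mul_add]
    omega
  rw [hw]
  funext i
  rw [gray_mk p hp, Nat.div_eq_of_lt he']
  have h2 : ((u.val % p + v.val % p : ℕ) : ZMod p) = (e : ZMod p) := by
    rw [he]; simp
  rw [← h2]
  simp only [Pi.add_apply, gray]
  push_cast
  ring

theorem gray_inj (p : ℕ) (hp : p.Prime) : Function.Injective (gray p) := by
  intro u v h
  have hpp := hp.pos
  have : NeZero p := ⟨hp.ne_zero⟩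
  have h0 := congrFun h ⟨0, hpp⟩
  have h1 := congrFun h ⟨1, hp.one_lt⟩
  simp only [gray, Nat.cast_zero, mul_zero, add_zero] at h0
  simp only [gray, Nat.cast_one, mul_one, h0, add_right_inj] at h1
  have key : ∀ x y : ℕ, x < p → y < p → (x : ZMod p) = y → x = y := by
    intro x y hx hy hxy
    rw [ZMod.natCast_eq_natCast_iff] at hxy
    exact Nat.ModEq.eq_of_lt_of_lt hxy hx hy
  have hd : ∀ w : ZMod (p ^ 2), w.val / p < p := fun w => by
    rw [Nat.div_lt_iff_lt_mul hpp, ← pow_two]; exact ZMod.val_lt w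
  have e0 := key _ _ (hd u) (hd v) h0
  have e1 := key _ _ (Nat.mod_lt _ hpp) (Nat.mod_lt _ hpp) h1
  apply ZMod.val_injective
  rw [← Nat.mod_add_div u.val p, ← Nat.mod_add_div v.val p, e0, e1]

theorem Gray_inj (p : ℕ) (hp : p.Prime) (α β : ℕ) : Function.Injective (Gray p α β) := by
  intro u v h
  simp only [Gray, Prod.mk.injEq] at h
  exact Prod.ext h.1 (funext fun j => gray_inj p hp (congrFun h.2 j))

theorem Gray_add (p : ℕ) (hp : p.Prime) (α β : ℕ)
    (u v : (Fin α → ZMod p) × (Fin β → ZMod (p ^ 2))) :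
    Gray p α β u + Gray p α β v = Gray p α β (u + v - pP p α β u v) := by
  refine Prod.ext ?_ (funext fun j => ?_)
  · simp [Gray, pP]
  · exact gray_add p hp (u.2 j) (v.2 j)

theorem Gray_zero (p α β : ℕ) : Gray p α β 0 = 0 := by
  refine Prod.ext rfl (funext fun j => funext fun i => ?_)
  simp [Gray, gray]

/-- `K(C) = Φ '' {u ∈ 𝒞 : ∀ v ∈ 𝒞, pP(u,v) ∈ 𝒞}`. -/
theorem kernel_eq (p : ℕ) (hp : p.Prime) (hodd : Odd p) (α β : ℕ)
    (𝒞 : AddSubgroup ((Fin α → ZMod p) × (Fin β → ZMod (p ^ 2)))) :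
    kernelSet (Gray p α β '' (𝒞 : Set ((Fin α → ZMod p) × (Fin β → ZMod (p ^ 2))))) =
      Gray p α β '' {u | u ∈ 𝒞 ∧ ∀ v ∈ 𝒞, pP p α β u v ∈ 𝒞} := by
  have : NeZero p := ⟨hp.ne_zero⟩
  ext x
  simp only [kernelSet, Set.mem_ofPred_eq]
  constructor
  · intro h
    have hsub : ∀ v ∈ 𝒞, x + Gray p α β v ∈ Gray p α β '' (𝒞 : Set _) := fun v hv => by
      have : x + Gray p α β v ∈ (fun c => x + c) '' (Gray p α β '' (𝒞 : Set _)) :=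
        ⟨_, ⟨v, hv, rfl⟩, rfl⟩
      rwa [h] at this
    obtain ⟨u, hu, hux⟩ := hsub 0 𝒞.zero_mem
    rw [Gray_zero, add_zero] at hux
    subst hux
    refine ⟨u, ⟨hu, fun v hv => ?_⟩, rfl⟩
    obtain ⟨w, hw, hwe⟩ := hsub v hv
    rw [Gray_add p hp] at hwe
    have := Gray_inj p hp α β hwe
    have e : pP p α β u v = u + v - w := by rw [this]; abel
    rw [e]
    exact 𝒞.sub_mem (𝒞.add_mem hu hv) hw
  · rintro ⟨u, ⟨hu, hP⟩, rfl⟩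
    apply Set.eq_of_subset_of_ncard_le _ _ (Set.toFinite _)
    · rintro _ ⟨_, ⟨v, hv, rfl⟩, rfl⟩
      exact ⟨_, 𝒞.sub_mem (𝒞.add_mem hu hv) (hP v hv), (Gray_add p hp α β u v).symm⟩
    · rw [Set.ncard_image_of_injective _ (add_right_injective _)]
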